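/- Let T = (V, E) be a finite tree, w : E → ℝ≥0 a nonnegative weight function, and δ_w the T-induced pseudometric. If p, q, r, s ∈ V are four distinct vertices such that ph_T(p, q) ∩ ph_T(r, s) = ∅, then δ_w(p, q) + δ_w(r, s) ≤ δ_w(p, r) + δ_w(q, s) and δ_w(p, r) + δ_w(q, s) = δ_w(p, s) + δ_w(q, r). -/

import Mathlib

open SimpleGraph Finset

/-- The unique path between two vertices of a tree. -/
noncomputable def treePath {V : Type*} {G : SimpleGraph V} (hG : G.IsTree) (u v : V) :
    G.Walk u v :=
  (hG.existsUnique_path u v).choose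

/-- `ph hG u v` is the set of edges lying on the unique path connecting `u` and `v` in the
tree `G`. -/
noncomputable def ph {V : Type*} [DecidableEq V] {G : SimpleGraph V} (hG : G.IsTree)
    (u v : V) : Finset (Sym2 V) :=
  (treePath hG u v).edges.toFinset

/-- The pseudometric induced by a tree with weight function `w` on its edges. -/
noncomputable def deltaW {V : Type*} [DecidableEq V] {G : SimpleGraph V} (hG : G.IsTree)
    (w : Sym2 V → ℝ) (u v : V) : ℝ :=
  ∑ e ∈ ph hG u v, w e

theorem mem_ph_iff {V : Type*} [DecidableEq V] {G : SimpleGraph V} (hG : G.IsTree)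
    {u v : V} {e : Sym2 V} : e ∈ ph hG u v ↔ ¬ (G.deleteEdges {e}).Reachable u v := by
  rw [ph, List.mem_toFinset]
  refine ⟨fun he hr ↦ ?_, (treePath hG u v).mem_edges_of_not_reachable_deleteEdges⟩
  induction e with | h x y
  obtain ⟨c, hc⟩ := reachable_deleteEdges_iff_exists_walk.mp hr
  have hpath : treePath hG u v = c.bypass := (hG.existsUnique_path u v).unique
    (hG.existsUnique_path u v).choose_spec.1 c.bypass_isPath
  exact hc (c.edges_bypass_subset_edges (hpath ▸ he))

theorem ph_subset_edgeSet {V : Type*} [DecidableEq V] {G : SimpleGraph V} (hG : G.IsTree)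
    {u v : V} {e : Sym2 V} (he : e ∈ ph hG u v) : e ∈ G.edgeSet :=
  (treePath hG u v).edges_subset_edgeSet (List.mem_toFinset.mp he)

/-- Deleting an edge from a connected graph leaves at most two components. -/
theorem SimpleGraph.Connected.reachable_deleteEdges_or {V : Type*} {G : SimpleGraph V}
    (hG : G.Connected) (x y v : V) :
    (G.deleteEdges {s(x, y)}).Reachable v x ∨ (G.deleteEdges {s(x, y)}).Reachable v y := by
  obtain ⟨c⟩ := hG v x
  induction c with
  | nil => exact .inl .rfl
  | @cons a b x hab _ ih =>
    by_cases he : s(a, b) = s(x, y)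
    · rcases Sym2.eq_iff.mp he with ⟨rfl, -⟩ | ⟨rfl, -⟩
      · exact .inl .rfl
      · exact .inr .rfl
    · have hr : (G.deleteEdges {s(x, y)}).Reachable a b :=
        Adj.reachable (deleteEdges_adj.mpr ⟨hab, he⟩)
      exact ih.imp hr.trans hr.trans

/-- Each edge of a tree splits the vertices into two sides, and lies on exactly the paths joining
vertices from different sides. -/
theorem exists_mem_ph_iff_side_ne {V : Type*} [DecidableEq V] {G : SimpleGraph V} (hG : G.IsTree)
    (e : Sym2 V) : ∃ S : V → Prop, ∀ u v, e ∈ ph hG u v ↔ ¬ (S u ↔ S v) := by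
  induction e with | h x y
  refine ⟨fun v ↦ (G.deleteEdges {s(x, y)}).Reachable v x, fun u v ↦ ?_⟩
  rw [mem_ph_iff, not_iff_not]
  refine ⟨fun h ↦ ⟨h.symm.trans, h.trans⟩, fun h ↦ ?_⟩
  by_cases hu : (G.deleteEdges {s(x, y)}).Reachable u x
  · exact hu.trans (h.mp hu).symm
  · exact ((hG.connected.reachable_deleteEdges_or x y u).resolve_left hu).trans
      ((hG.connected.reachable_deleteEdges_or x y v).resolve_left (mt h.mpr hu)).symm

theorem deltaW_eq_sum_ite {V : Type*} [Fintype V] [DecidableEq V] {G : SimpleGraph V}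
    (hG : G.IsTree) (w : Sym2 V → ℝ) (u v : V) :
    deltaW hG w u v = ∑ e, if e ∈ ph hG u v then w e else 0 := by
  rw [deltaW, Finset.sum_ite_mem, Finset.univ_inter]

/-- If `p, q, r, s` are four distinct vertices of a finite tree such that the
paths connecting `p,q` and `r,s` are edge-disjoint, then
`δ_w(p,q) + δ_w(r,s) ≤ δ_w(p,r) + δ_w(q,s)` and `δ_w(p,r) + δ_w(q,s) = δ_w(p,s) + δ_w(q,r)`. -/
theorem stmt1 {V : Type*} [Fintype V] [DecidableEq V] {G : SimpleGraph V} (hG : G.IsTree)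
    (w : Sym2 V → ℝ) (hw : ∀ e ∈ G.edgeSet, 0 ≤ w e)
    (p q r s : V) (hpq : p ≠ q) (hpr : p ≠ r) (hps : p ≠ s)
    (hqr : q ≠ r) (hqs : q ≠ s) (hrs : r ≠ s)
    (hdisj : ph hG p q ∩ ph hG r s = ∅) :
    deltaW hG w p q + deltaW hG w r s ≤ deltaW hG w p r + deltaW hG w q s ∧
      deltaW hG w p r + deltaW hG w q s = deltaW hG w p s + deltaW hG w q r := by
  have hnot : ∀ e, ¬ (e ∈ ph hG p q ∧ e ∈ ph hG r s) := fun e he ↦ by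
    simpa [hdisj] using Finset.mem_inter.mpr he
  simp only [deltaW_eq_sum_ite, ← Finset.sum_add_distrib]
  constructor
  · refine Finset.sum_le_sum fun e _ ↦ ?_
    by_cases he : e ∈ G.edgeSet
    · have hwe := hw e he
      have hn := hnot e
      obtain ⟨S, hS⟩ := exists_mem_ph_iff_side_ne hG e
      simp only [hS] at hn ⊢
      by_cases hp : S p <;> by_cases hq : S q <;> by_cases hr : S r <;> by_cases hs : S s <;>
        simp_all
    · simp [mt (ph_subset_edgeSet hG) he]
  · refine Finset.sum_congr rfl fun e _ ↦ ?_
    have hn := hnot e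
    obtain ⟨S, hS⟩ := exists_mem_ph_iff_side_ne hG e
    simp only [hS] at hn ⊢
    by_cases hp : S p <;> by_cases hq : S q <;> by_cases hr : S r <;> by_cases hs : S s <;>
      simp_all
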